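/- Let O ⊂ A be an extension of Dedekind domains as in the different setting (A the integral closure of O in a finite separable extension of Frac(O)), and let N be a torsion-free A-module. Then the multiplication map A⊗_O N → N induces an isomorphism of A-modules {x ∈ A⊗_O N : (a⊗1)x = (1⊗a)x for all a ∈ A} ≅ d_{A/O}·N. -/

import Mathlib

open TensorProduct


lemma lTensor_leftSMul_comm (O A : Type*) [CommRing O] [CommRing A] [Algebra O A]
    (N N' : Type*) [AddCommGroup N] [Module O N] [AddCommGroup N'] [Module O N']
    (f : N →ₗ[O] N') (c : A) (x : A ⊗[O] N) :
    LinearMap.lTensor A f (c • x) = c • LinearMap.lTensor A f x := by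
  induction x using TensorProduct.induction_on with
  | zero => simp
  | tmul a n => simp [TensorProduct.smul_tmul']
  | add u v hu hv => simp [smul_add, hu, hv]

/-- The `A`-submodule `{x ∈ A ⊗[O] N | ∀ a ∈ A, (a⊗1)x = (1⊗a)x}` of `A ⊗[O] N`,
where `A` acts through the left tensor factor and `(1⊗a)` acts through the
`A`-module structure of `N`. -/
def condSub (O A : Type*) [CommRing O] [CommRing A] [Algebra O A]
    (N : Type*) [AddCommGroup N] [Module O N] [Module A N] [IsScalarTower O A N] :
    Submodule A (A ⊗[O] N) where
  carrier := {x | ∀ a : A,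
    a • x = LinearMap.lTensor A ((LinearMap.lsmul A N a).restrictScalars O) x}
  add_mem' := fun hx hy a => by rw [smul_add, map_add, hx a, hy a]
  zero_mem' := fun a => by rw [smul_zero, map_zero]
  smul_mem' := fun c x hx a => by
    rw [smul_comm, hx a, lTensor_leftSMul_comm]

/-- The multiplication map `A ⊗[O] N → N`, `a ⊗ n ↦ a • n`. -/
noncomputable def mulMapAN (O A : Type*) [CommRing O] [CommRing A] [Algebra O A]
    (N : Type*) [AddCommGroup N] [Module O N] [Module A N] [IsScalarTower O A N]
    [SMulCommClass A O N] :
    A ⊗[O] N →ₗ[O] N :=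
  TensorProduct.lift (LinearMap.mk₂ O (fun a n => a • n)
    (fun a b n => add_smul a b n) (fun c a n => smul_assoc c a n)
    (fun a m n => smul_add a m n) (fun c a n => smul_comm a c n))

section Contraction

variable {O A N : Type*} [CommRing O] [CommRing A] [Algebra O A] [AddCommGroup N] [Module O N]

/-- Contraction of the left tensor factor against a functional `f : A → O`. -/
noncomputable def contractDual (N : Type*) [AddCommGroup N] [Module O N] (f : A →ₗ[O] O) :
    A ⊗[O] N →ₗ[O] N :=
  TensorProduct.lid O N ∘ₗ LinearMap.rTensor N f

@[simp]
lemma contractDual_tmul (f : A →ₗ[O] O) (a : A) (n : N) :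
    contractDual N f (a ⊗ₜ n) = f a • n := by
  simp [contractDual]

lemma contractDual_add (f g : A →ₗ[O] O) (x : A ⊗[O] N) :
    contractDual N (f + g) x = contractDual N f x + contractDual N g x := by
  simp [contractDual, LinearMap.rTensor_add]

lemma contractDual_sum {ι : Type*} (s : Finset ι) (f : ι → A →ₗ[O] O) (x : A ⊗[O] N) :
    contractDual N (∑ i ∈ s, f i) x = ∑ i ∈ s, contractDual N (f i) x := by
  induction x using TensorProduct.induction_on with
  | zero => simp
  | tmul a n => simp [Finset.sum_smul]
  | add u v hu hv => simp [hu, hv, Finset.sum_add_distrib]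

lemma contractDual_smul (f : A →ₗ[O] O) (a : A) (x : A ⊗[O] N) :
    contractDual N f (a • x) = contractDual N (f ∘ₗ LinearMap.mulLeft O a) x := by
  induction x using TensorProduct.induction_on with
  | zero => simp
  | tmul b n => simp [TensorProduct.smul_tmul']
  | add u v hu hv => simp only [smul_add, map_add, hu, hv]

lemma contractDual_lTensor {N' : Type*} [AddCommGroup N'] [Module O N'] (f : A →ₗ[O] O)
    (g : N →ₗ[O] N') (x : A ⊗[O] N) :
    contractDual N' f (LinearMap.lTensor A g x) = g (contractDual N f x) := by
  induction x using TensorProduct.induction_on with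
  | zero => simp
  | tmul b n => simp
  | add u v hu hv => simp only [map_add, hu, hv]

lemma sum_tmul_contractDual {ι : Type*} [Fintype ι] {e : ι → A} {f : ι → A →ₗ[O] O}
    (hef : ∀ a, ∑ i, f i a • e i = a) (x : A ⊗[O] N) :
    ∑ i, e i ⊗ₜ[O] contractDual N (f i) x = x := by
  induction x using TensorProduct.induction_on with
  | zero => simp
  | tmul b n =>
    conv_rhs => rw [← hef b, TensorProduct.sum_tmul]
    simp [TensorProduct.smul_tmul]
  | add u v hu hv => simp only [map_add, TensorProduct.tmul_add, Finset.sum_add_distrib, hu, hv]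

lemma eq_of_forall_contractDual_eq {ι : Type*} [Fintype ι] {e : ι → A} {f : ι → A →ₗ[O] O}
    (hef : ∀ a, ∑ i, f i a • e i = a) {x y : A ⊗[O] N}
    (h : ∀ g : A →ₗ[O] O, contractDual N g x = contractDual N g y) : x = y := by
  rw [← sum_tmul_contractDual hef x, ← sum_tmul_contractDual hef y]
  simp only [h]

variable [Module A N] [IsScalarTower O A N]

lemma contractDual_comp_mulLeft {x : A ⊗[O] N} (hx : x ∈ condSub O A N) (f : A →ₗ[O] O) (a : A) :
    contractDual N (f ∘ₗ LinearMap.mulLeft O a) x = a • contractDual N f x := by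
  rw [← contractDual_smul, hx a, contractDual_lTensor]
  rfl

variable [SMulCommClass A O N]

@[simp]
lemma mulMapAN_tmul (a : A) (n : N) : mulMapAN O A N (a ⊗ₜ n) = a • n := by
  simp [mulMapAN]

lemma mulMapAN_smul (a : A) (x : A ⊗[O] N) : mulMapAN O A N (a • x) = a • mulMapAN O A N x := by
  induction x using TensorProduct.induction_on with
  | zero => simp
  | tmul b n => simp [TensorProduct.smul_tmul', mul_smul]
  | add u v hu hv => simp only [smul_add, map_add, hu, hv]

end Contraction

lemma exists_projective_dualBasis (R M : Type*) [CommRing R] [AddCommGroup M] [Module R M]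
    [Module.Finite R M] [Module.Projective R M] :
    ∃ (n : ℕ) (e : Fin n → M) (f : Fin n → M →ₗ[R] R), ∀ a, ∑ i, f i a • e i = a := by
  obtain ⟨n, p, s, -, -, hps⟩ := Module.Finite.exists_comp_eq_id_of_projective R M
  refine ⟨n, fun i => p (Pi.single i 1), fun i => LinearMap.proj i ∘ₗ s, fun a => ?_⟩
  conv_rhs => rw [← LinearMap.id_apply (R := R) a, ← hps, LinearMap.comp_apply,
    pi_eq_sum_univ' (s a)]
  simp [map_sum]

section Codifferent

open scoped nonZeroDivisors

variable {O A : Type*} (F K : Type*) [CommRing O] [IsDomain O] [CommRing A] [Algebra O A]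
  [Field F] [Field K] [Algebra O F] [IsFractionRing O F] [Algebra A K]
  [Algebra F K] [Algebra O K] [IsScalarTower O F K] [IsScalarTower O A K]
  [FiniteDimensional F K] [IsIntegralClosure A O K]

lemma exists_eq_trace_mul [Algebra.IsSeparable F K] (f : A →ₗ[O] O) :
    ∃ c : K, ∀ a, algebraMap O F (f a) = Algebra.trace F K (c * algebraMap A K a) := by
  have : IsLocalization (Algebra.algebraMapSubmonoid A O⁰) K :=
    IsIntegralClosure.isLocalization O F K A
  let ι : A →ₗ[O] K := (IsScalarTower.toAlgHom O A K).toLinearMap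
  have : IsLocalizedModule O⁰ ι := isLocalizedModule_iff_isLocalization.mpr this
  let j : O →ₗ[O] F := Algebra.linearMap O F
  have : IsLocalizedModule O⁰ j := inferInstance
  let g : K →ₗ[F] F := (IsLocalizedModule.map O⁰ ι j f).extendScalarsOfIsLocalization O⁰ F
  refine ⟨((Algebra.traceForm F K).toDual (traceForm_nondegenerate F K)).symm g, fun a => ?_⟩
  rw [← Algebra.traceForm_apply, LinearMap.BilinForm.apply_toDual_symm_apply]
  exact (IsLocalizedModule.map_apply O⁰ ι j f a).symm

variable {F K}

lemma sum_trace_smul_eq {ι : Type*} [Fintype ι] {e : ι → A} {f : ι → A →ₗ[O] O}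
    (hef : ∀ a, ∑ i, f i a • e i = a) {c : ι → K}
    (hc : ∀ i a, algebraMap O F (f i a) = Algebra.trace F K (c i * algebraMap A K a)) (k : K) :
    ∑ i, Algebra.trace F K (c i * k) • algebraMap A K (e i) = k := by
  have : IsLocalization (Algebra.algebraMapSubmonoid A O⁰) K :=
    IsIntegralClosure.isLocalization O F K A
  obtain ⟨⟨a, ⟨_, s, hs, rfl⟩⟩, hk⟩ :=
    IsLocalization.surj (Algebra.algebraMapSubmonoid A O⁰) k
  have hs0 : algebraMap O F s ≠ 0 := by
    simpa using nonZeroDivisors.ne_zero hs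
  have hk' : algebraMap O F s • k = algebraMap A K a := by
    rw [← hk, Algebra.smul_def, ← IsScalarTower.algebraMap_apply,
      ← IsScalarTower.algebraMap_apply, mul_comm]
  refine smul_right_injective K hs0 ?_
  simp only [Finset.smul_sum, smul_smul, ← smul_eq_mul (a := algebraMap O F s), ← map_smul,
    ← mul_smul_comm, hk', ← hc]
  conv_rhs => rw [← hef a, map_sum]
  refine Finset.sum_congr rfl fun i _ => ?_
  rw [Algebra.smul_def, Algebra.smul_def, map_mul, ← IsScalarTower.algebraMap_apply,
    ← IsScalarTower.algebraMap_apply]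

lemma trace_eq_sum_trace {ι : Type*} [Fintype ι] {e : ι → A} {f : ι → A →ₗ[O] O}
    (hef : ∀ a, ∑ i, f i a • e i = a) {c : ι → K}
    (hc : ∀ i a, algebraMap O F (f i a) = Algebra.trace F K (c i * algebraMap A K a)) (k : K) :
    Algebra.trace F K k = ∑ i, Algebra.trace F K (c i * (k * algebraMap A K (e i))) := by
  have h : Algebra.lmul F K k = ∑ i, (Algebra.trace F K ∘ₗ LinearMap.mulLeft F (c i) ∘ₗ
      LinearMap.mulLeft F k).smulRight (algebraMap A K (e i)) := by
    ext l
    simpa using (sum_trace_smul_eq hef hc (k * l)).symm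
  rw [Algebra.trace_apply, h, map_sum]
  simp

lemma sum_mul_eq_one [Algebra.IsSeparable F K]
    {ι : Type*} [Fintype ι] {e : ι → A} {f : ι → A →ₗ[O] O}
    (hef : ∀ a, ∑ i, f i a • e i = a) {c : ι → K}
    (hc : ∀ i a, algebraMap O F (f i a) = Algebra.trace F K (c i * algebraMap A K a)) :
    ∑ i, algebraMap A K (e i) * c i = 1 := by
  refine sub_eq_zero.mp ((traceForm_nondegenerate F K).1 _ fun k => ?_)
  rw [map_sub, LinearMap.sub_apply, Algebra.traceForm_apply, Algebra.traceForm_apply, one_mul,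
    trace_eq_sum_trace hef hc k, Finset.sum_mul, map_sum, sub_eq_zero]
  exact Finset.sum_congr rfl fun i _ => congrArg _ (by ring)

/-- The coefficients representing a projective dual basis through the trace form expand every
element of `K`. -/
lemma sum_trace_smul_dual_eq [Algebra.IsSeparable F K]
    {ι : Type*} [Fintype ι] {e : ι → A} {f : ι → A →ₗ[O] O}
    (hef : ∀ a, ∑ i, f i a • e i = a) {c : ι → K}
    (hc : ∀ i a, algebraMap O F (f i a) = Algebra.trace F K (c i * algebraMap A K a)) (z : K) :
    ∑ i, Algebra.trace F K (z * algebraMap A K (e i)) • c i = z := by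
  refine sub_eq_zero.mp ((traceForm_nondegenerate F K).1 _ fun k => ?_)
  rw [map_sub, LinearMap.sub_apply, Algebra.traceForm_apply, Algebra.traceForm_apply, sub_eq_zero]
  conv_rhs => rw [← sum_trace_smul_eq hef hc k]
  simp [Finset.mul_sum, mul_comm]

lemma eq_of_forall_trace_mul_eq [Algebra.IsSeparable F K]
    {ι : Type*} [Fintype ι] {e : ι → A} {f : ι → A →ₗ[O] O}
    (hef : ∀ a, ∑ i, f i a • e i = a) {y z : K}
    (h : ∀ a, Algebra.trace F K (y * algebraMap A K a) =
      Algebra.trace F K (z * algebraMap A K a)) : y = z := by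
  choose c hc using fun i => exists_eq_trace_mul F K (f i)
  rw [← sum_trace_smul_dual_eq hef hc y, ← sum_trace_smul_dual_eq hef hc z]
  simp only [h]

lemma mem_dual_one_iff [IsDedekindDomain A] [IsFractionRing A K]
    [IsIntegrallyClosed O] [Algebra.IsSeparable F K] {c : K} :
    c ∈ FractionalIdeal.dual O F (1 : FractionalIdeal A⁰ K) ↔
      ∃ f : A →ₗ[O] O, ∀ a, algebraMap O F (f a) = Algebra.trace F K (c * algebraMap A K a) := by
  rw [FractionalIdeal.mem_dual (one_ne_zero' (FractionalIdeal A⁰ K))]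
  constructor
  · intro h
    have h' (a : A) : Algebra.trace F K (c * algebraMap A K a) ∈ (algebraMap O F).range :=
      h _ (FractionalIdeal.mem_one_iff _ |>.mpr ⟨a, rfl⟩)
    choose f hf using h'
    refine ⟨⟨⟨f, fun a b => ?_⟩, fun r a => ?_⟩, hf⟩
    · apply IsFractionRing.injective O F
      simp [hf, mul_add]
    · apply IsFractionRing.injective O F
      simp only [hf, RingHom.id_apply, smul_eq_mul, map_mul]
      rw [← smul_eq_mul (algebraMap O F r), ← map_smul, Algebra.smul_def r, Algebra.smul_def,
        map_mul (algebraMap A K), ← IsScalarTower.algebraMap_apply, ← IsScalarTower.algebraMap_apply,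
        mul_left_comm]
  · rintro ⟨f, hf⟩ _ ha
    obtain ⟨a, rfl⟩ := (FractionalIdeal.mem_one_iff _).mp ha
    exact ⟨f a, hf a⟩

variable {N : Type*} [AddCommGroup N] [Module O N] [Module A N] [IsScalarTower O A N]
  [SMulCommClass A O N] {ι : Type*} [Fintype ι] {e : ι → A} {f : ι → A →ₗ[O] O}

lemma contractDual_eq_mulMapAN [Algebra.IsSeparable F K] (hef : ∀ a, ∑ i, f i a • e i = a)
    {t : A →ₗ[O] O} (ht : ∀ a, algebraMap O F (t a) = Algebra.trace F K (algebraMap A K a))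
    {x : A ⊗[O] N} (hx : x ∈ condSub O A N) :
    contractDual N t x = mulMapAN O A N x := by
  choose c hc using fun i => exists_eq_trace_mul F K (f i)
  have htf : t = ∑ i, f i ∘ₗ LinearMap.mulLeft O (e i) := by
    ext a
    apply IsFractionRing.injective O F
    rw [ht, trace_eq_sum_trace hef hc]
    simp [hc, mul_comm]
  conv_rhs => rw [← sum_tmul_contractDual hef x]
  simp [htf, contractDual_sum, contractDual_comp_mulLeft hx]

lemma eq_zero_of_mulMapAN_eq_zero [IsDomain A] [IsFractionRing A K] [Algebra.IsSeparable F K]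
    (htf : ∀ (a : A) (n : N), a ≠ 0 → a • n = 0 → n = 0) (hef : ∀ a, ∑ i, f i a • e i = a)
    {t : A →ₗ[O] O} (ht : ∀ a, algebraMap O F (t a) = Algebra.trace F K (algebraMap A K a))
    {x : A ⊗[O] N} (hx : x ∈ condSub O A N) (h0 : mulMapAN O A N x = 0) : x = 0 := by
  refine eq_of_forall_contractDual_eq hef fun g => ?_
  obtain ⟨c, hc⟩ := exists_eq_trace_mul F K g
  obtain ⟨b, a, ha, rfl⟩ := IsFractionRing.div_surjective (A := A) c
  have ha0 : algebraMap A K a ≠ 0 := by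
    simpa using nonZeroDivisors.ne_zero ha
  have hg : g ∘ₗ LinearMap.mulLeft O a = t ∘ₗ LinearMap.mulLeft O b := by
    ext y
    apply IsFractionRing.injective O F
    simp only [LinearMap.comp_apply, LinearMap.mulLeft_apply, hc, ht, map_mul]
    congr 1
    field_simp
  rw [map_zero]
  refine htf a _ (nonZeroDivisors.ne_zero ha) ?_
  rw [← contractDual_comp_mulLeft hx, hg, contractDual_comp_mulLeft hx,
    contractDual_eq_mulMapAN hef ht hx, h0, smul_zero]

end Codifferent

section DifferentIdeal

open scoped nonZeroDivisors

lemma mulMapAN_mem_differentIdeal_smul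
    {O A : Type*} (F K : Type*) [CommRing O] [IsDomain O] [IsIntegrallyClosed O]
    [CommRing A] [IsDedekindDomain A] [Algebra O A] [Module.IsTorsionFree O A]
    [Field F] [Field K] [Algebra O F] [IsFractionRing O F] [Algebra A K] [IsFractionRing A K]
    [Algebra F K] [Algebra O K] [IsScalarTower O F K] [IsScalarTower O A K]
    [FiniteDimensional F K] [Algebra.IsSeparable F K] [IsIntegralClosure A O K]
    {N : Type*} [AddCommGroup N] [Module O N] [Module A N] [IsScalarTower O A N]
    [SMulCommClass A O N] {ι : Type*} [Fintype ι] {e : ι → A} {f : ι → A →ₗ[O] O}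
    (hef : ∀ a, ∑ i, f i a • e i = a)
    {x : A ⊗[O] N} (hx : x ∈ condSub O A N) :
    mulMapAN O A N x ∈ differentIdeal O A • (⊤ : Submodule A N) := by
  have key (z : K) (hz : z ∈ (differentIdeal O A : FractionalIdeal A⁰ K) *
      FractionalIdeal.dual O F (1 : FractionalIdeal A⁰ K)) :
      ∃ g : A →ₗ[O] O, (∀ a, algebraMap O F (g a) = Algebra.trace F K (z * algebraMap A K a)) ∧
        contractDual N g x ∈ differentIdeal O A • (⊤ : Submodule A N) := by
    refine FractionalIdeal.mul_induction_on hz (fun y hy c hc => ?_) fun y z hy hz => ?_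
    · obtain ⟨d, hd, rfl⟩ := (FractionalIdeal.mem_coeIdeal _).mp hy
      obtain ⟨g, hg⟩ := mem_dual_one_iff.mp hc
      refine ⟨g ∘ₗ LinearMap.mulLeft O d, fun a => ?_, ?_⟩
      · simp only [LinearMap.comp_apply, LinearMap.mulLeft_apply, hg, map_mul]
        congr 1
        ring
      · rw [contractDual_comp_mulLeft hx]
        exact Submodule.smul_mem_smul hd Submodule.mem_top
    · obtain ⟨g, hg, hgx⟩ := hy
      obtain ⟨h, hh, hhx⟩ := hz
      refine ⟨g + h, fun a => ?_, ?_⟩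
      · simp [hg, hh, add_mul]
      · rw [contractDual_add]
        exact add_mem hgx hhx
  rw [coeIdeal_differentIdeal O F K A,
    inv_mul_cancel₀ (FractionalIdeal.dual_ne_zero O F (one_ne_zero' (FractionalIdeal A⁰ K)))] at key
  obtain ⟨g, hg, hgx⟩ := key 1 ((FractionalIdeal.mem_one_iff _).mpr ⟨1, map_one _⟩)
  rwa [← contractDual_eq_mulMapAN hef (F := F) (K := K) (fun a => by rw [hg, one_mul]) hx]

lemma exists_mulMapAN_eq_smul
    {O A : Type*} (F K : Type*) [CommRing O] [IsDomain O] [IsIntegrallyClosed O]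
    [CommRing A] [IsDedekindDomain A] [Algebra O A] [Module.IsTorsionFree O A]
    [Field F] [Field K] [Algebra O F] [IsFractionRing O F] [Algebra A K] [IsFractionRing A K]
    [Algebra F K] [Algebra O K] [IsScalarTower O F K] [IsScalarTower O A K]
    [FiniteDimensional F K] [Algebra.IsSeparable F K] [IsIntegralClosure A O K]
    {N : Type*} [AddCommGroup N] [Module O N] [Module A N] [IsScalarTower O A N]
    [SMulCommClass A O N] {ι : Type*} [Fintype ι] {e : ι → A} {f : ι → A →ₗ[O] O}
    (hef : ∀ a, ∑ i, f i a • e i = a) {d : A}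
    (hd : d ∈ differentIdeal O A) (n : N) :
    ∃ x ∈ condSub O A N, mulMapAN O A N x = d • n := by
  choose c hc using exists_eq_trace_mul (A := A) (O := O) F K
  have hdc (g : A →ₗ[O] O) : ∃ r : A, algebraMap A K r = algebraMap A K d * c g := by
    rw [← FractionalIdeal.mem_one_iff A⁰,
      ← inv_mul_cancel₀ (FractionalIdeal.dual_ne_zero O F (one_ne_zero' (FractionalIdeal A⁰ K))),
      ← coeIdeal_differentIdeal O F K A]
    exact FractionalIdeal.mul_mem_mul ((FractionalIdeal.mem_coeIdeal _).mpr ⟨d, hd, rfl⟩)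
      (mem_dual_one_iff.mpr ⟨g, hc g⟩)
  choose r hr using hdc
  have hinj := IsFractionRing.injective A K
  have hrmul (g : A →ₗ[O] O) (a : A) : r (g ∘ₗ LinearMap.mulLeft O a) = a * r g := by
    have : c (g ∘ₗ LinearMap.mulLeft O a) = algebraMap A K a * c g :=
      eq_of_forall_trace_mul_eq (F := F) hef fun b => by
        rw [← hc, LinearMap.comp_apply, LinearMap.mulLeft_apply, hc, map_mul (algebraMap A K)]
        congr 1
        ring
    apply hinj
    rw [hr, this, map_mul, hr, mul_left_comm]
  have hrsum (g : A →ₗ[O] O) : ∑ i, g (e i) • r (f i) = r g := by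
    apply hinj
    rw [hr]
    conv_rhs => rw [← sum_trace_smul_dual_eq hef (fun i => hc (f i)) (c g)]
    simp only [map_sum, Finset.mul_sum, ← hc]
    refine Finset.sum_congr rfl fun i _ => ?_
    rw [algebraMap_smul, Algebra.smul_def, Algebra.smul_def, map_mul, hr,
      ← IsScalarTower.algebraMap_apply, mul_left_comm]
  have hcontract (g : A →ₗ[O] O) :
      contractDual N g (∑ i, e i ⊗ₜ[O] (r (f i) • n)) = r g • n := by
    simp [← hrsum g, Finset.sum_smul]
  refine ⟨∑ i, e i ⊗ₜ[O] (r (f i) • n), fun a => ?_, ?_⟩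
  · refine eq_of_forall_contractDual_eq hef fun g => ?_
    rw [contractDual_smul, hcontract, hrmul, contractDual_lTensor, hcontract, mul_smul]
    rfl
  · simp only [map_sum, mulMapAN_tmul, smul_smul, ← Finset.sum_smul]
    congr 1
    apply hinj
    conv_rhs => rw [← mul_one (algebraMap A K d), ← sum_mul_eq_one hef (fun i => hc (f i))]
    simp only [map_sum, map_mul, hr, Finset.mul_sum]
    exact Finset.sum_congr rfl fun i _ => mul_left_comm _ _ _

end DifferentIdeal

/-- for `A` the integral closure of the Dedekind domain `O` in a finite separable
extension of `Frac O`, and `N` a torsion-free `A`-module, the multiplication map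
`A ⊗[O] N → N` induces an isomorphism of `A`-modules
`{x ∈ A ⊗[O] N | ∀ a, (a⊗1)x = (1⊗a)x} ≅ d_{A/O}·N`. -/
theorem stmt6 (O A F K : Type*)
    [CommRing O] [IsDomain O] [IsDedekindDomain O]
    [CommRing A] [IsDomain A] [IsDedekindDomain A]
    [Algebra O A] [NoZeroSMulDivisors O A]
    [Field F] [Field K]
    [Algebra O F] [IsFractionRing O F]
    [Algebra A K] [IsFractionRing A K]
    [Algebra F K] [Algebra O K]
    [IsScalarTower O F K] [IsScalarTower O A K]
    [FiniteDimensional F K] [Algebra.IsSeparable F K]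
    [IsIntegralClosure A O K]
    (N : Type*) [AddCommGroup N] [Module O N] [Module A N] [IsScalarTower O A N]
    [SMulCommClass A O N]
    (htf : ∀ (a : A) (n : N), a ≠ 0 → a • n = 0 → n = 0) :
    ∃ e : (condSub O A N) ≃ₗ[A] ↥(differentIdeal O A • (⊤ : Submodule A N)),
      ∀ x : condSub O A N, (e x : N) = mulMapAN O A N x.1 := by
  have : Module.Finite O A := IsIntegralClosure.finite O F K A
  have : Module.IsTorsionFree O A := inferInstance
  have : Module.FinitePresentation O A := Module.finitePresentation_of_finite O A
  have : Module.Projective O A := Module.Flat.projective_of_finitePresentation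
  obtain ⟨m, b, f, hbf⟩ := exists_projective_dualBasis O A
  have ht (a : A) := Algebra.algebraMap_intTrace (K := F) (L := K) (A := O) a
  let μ : condSub O A N →ₗ[A] N :=
    { toFun := fun x => mulMapAN O A N x.1
      map_add' := fun x y => by simp
      map_smul' := fun a x => mulMapAN_smul a x.1 }
  have hμ : Function.Injective μ := by
    intro x y hxy
    refine Subtype.ext (sub_eq_zero.mp (eq_zero_of_mulMapAN_eq_zero htf hbf ht
      (sub_mem x.2 y.2) ?_))
    rw [map_sub]
    exact sub_eq_zero.mpr hxy
  have hrange : LinearMap.range μ = differentIdeal O A • (⊤ : Submodule A N) := by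
    refine le_antisymm ?_ (Submodule.smul_le.mpr fun d hd n _ => ?_)
    · rintro _ ⟨x, rfl⟩
      exact mulMapAN_mem_differentIdeal_smul F K hbf x.2
    · obtain ⟨x, hx, hxn⟩ := exists_mulMapAN_eq_smul F K hbf hd n
      exact ⟨⟨x, hx⟩, hxn⟩
  exact ⟨(LinearEquiv.ofInjective μ hμ).trans (LinearEquiv.ofEq _ _ hrange), fun _ => rfl⟩
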